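/- Let k ≥ 2 and (x_n)_{n≥1} ⊆ [0,1] be an arbitrary sequence. There exist constants s_0 > 0 and C > 0 depending only on k such that for all s ≥ s_0: (a) for every N ≥ 1 sufficiently large (N ≥ N_0(s,k)), R_k(s,N) ≤ R_k^*(s,N) ≤ R_k(s,N) + (C/s)·R_k(3^k·s, N); moreover (b) if (x_n) has Poissonian k-th order correlations, then for all s ≥ s_0, limsup_{N→∞} |R_k^*(s,N) − (2s)^{k-1}| ≤ C·s^{k-2}. -/

import Mathlib

open Finset Filter MeasureTheory
open scoped Classical ENNReal NNReal

/-- Distance from `x` to the nearest integer. -/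
noncomputable def nint (x : ℝ) : ℝ := |x - round x|

/-- Signed distance from `x` to the origin modulo 1. -/
noncomputable def sdist (x : ℝ) : ℝ :=
  if Int.fract x ≤ 1 / 2 then Int.fract x else Int.fract x - 1

/-- Number of `k`-tuples of pairwise distinct indices in `{1,…,N}` whose rescaled signed
differences lie in the box `∏ r, [a r, b r]`. -/
noncomputable def corrBoxCount (x : ℕ → ℝ) (k N : ℕ) (a b : Fin (k - 1) → ℝ) : ℕ :=
  ((Fintype.piFinset fun _ : Fin k => Finset.Icc 1 N).filter fun i =>
    Function.Injective i ∧ ∀ r : Fin (k - 1),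
      (N : ℝ) * sdist (x (i ⟨0, by have := r.2; omega⟩) - x (i ⟨r.1 + 1, by have := r.2; omega⟩))
        ∈ Set.Icc (a r) (b r)).card

/-- The sequence `x` (indexed by `n ≥ 1`) has Poissonian correlations of order `k`. -/
def HasPoissonianCorr (x : ℕ → ℝ) (k : ℕ) : Prop :=
  ∀ a b : Fin (k - 1) → ℝ, (∀ r, a r ≤ b r) →
    Tendsto (fun N : ℕ => (corrBoxCount x k N a b : ℝ) / N) atTop
      (nhds (∏ r, (b r - a r)))

/-- The `k`-th order correlation function `R_k(s₁,…,s_{k-1},N)` (pairwise distinct indices). -/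
noncomputable def Rcorr (x : ℕ → ℝ) (k N : ℕ) (s : Fin (k - 1) → ℝ) : ℝ :=
  (((Fintype.piFinset fun _ : Fin k => Finset.Icc 1 N).filter fun i =>
    Function.Injective i ∧ ∀ r : Fin (k - 1),
      nint (x (i ⟨0, by have := r.2; omega⟩) - x (i ⟨r.1 + 1, by have := r.2; omega⟩))
        ≤ s r / N).card : ℝ) / N

/-- The `k`-th order correlation function `R_k^*(s₁,…,s_{k-1},N)` (indices not necessarily
distinct). -/
noncomputable def RcorrStar (x : ℕ → ℝ) (k N : ℕ) (s : Fin (k - 1) → ℝ) : ℝ :=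
  (((Fintype.piFinset fun _ : Fin k => Finset.Icc 1 N).filter fun i =>
    ∀ r : Fin (k - 1),
      nint (x (i ⟨0, by have := r.2; omega⟩) - x (i ⟨r.1 + 1, by have := r.2; omega⟩))
        ≤ s r / N).card : ℝ) / N

theorem nint_le_abs (x : ℝ) : nint x ≤ |x| := by
  simpa [nint] using round_le x 0

theorem nint_zero : nint 0 = 0 := by simp [nint]

theorem abs_sdist (x : ℝ) : |sdist x| = nint x := by
  rw [nint, abs_sub_round_eq_min, sdist]
  have h0 := Int.fract_nonneg x
  have h1 := Int.fract_lt_one x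
  split_ifs with h
  · rw [abs_of_nonneg h0, min_eq_left (by linarith)]
  · rw [abs_of_nonpos (by linarith), min_eq_right (by linarith)]
    ring

theorem mul_sdist_mem_Icc_iff {N : ℝ} (hN : 0 < N) (s x : ℝ) :
    N * sdist x ∈ Set.Icc (-s) s ↔ nint x ≤ s / N := by
  rw [Set.mem_Icc, ← abs_le, abs_mul, abs_of_pos hN, abs_sdist, le_div_iff₀' hN]

/-- The indices `j ∈ {1,…,N}` with `x j` within circle distance `s / N` of `x n`. -/
noncomputable def neighbours (x : ℕ → ℝ) (N : ℕ) (s : ℝ) (n : ℕ) : Finset ℕ :=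
  (Finset.Icc 1 N).filter fun j => nint (x n - x j) ≤ s / N

theorem self_mem_neighbours (x : ℕ → ℝ) {N n : ℕ} {s : ℝ} (hs : 0 ≤ s)
    (hn : n ∈ Finset.Icc 1 N) : n ∈ neighbours x N s n := by
  simp only [neighbours, Finset.mem_filter, sub_self, nint_zero]
  exact ⟨hn, by positivity⟩

theorem card_filter_injective_piFinset (S : Finset ℕ) (m : ℕ) :
    ((Fintype.piFinset fun _ : Fin m => S).filter Function.Injective).card
      = S.card.descFactorial m := by
  have h := Fintype.card_embedding_eq (α := Fin m) (β := S)
  rw [Fintype.card_fin, Fintype.card_coe] at h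
  rw [← h, ← Finset.card_univ]
  symm
  refine Finset.card_bij (fun f _ r => (f r : ℕ)) ?_ ?_ ?_
  · intro f _
    simp only [Finset.mem_filter, Fintype.mem_piFinset]
    exact ⟨fun r => (f r).2, Subtype.val_injective.comp f.injective⟩
  · intro f _ g _ hfg
    ext r
    exact congrFun hfg r
  · intro g hg
    simp only [Finset.mem_filter, Fintype.mem_piFinset] at hg
    refine ⟨⟨fun r => ⟨g r, hg.1 r⟩, fun a b hab => hg.2 ?_⟩, Finset.mem_univ _, rfl⟩
    simpa using hab

theorem RcorrStar_eq_sum (x : ℕ → ℝ) (m N : ℕ) (s : ℝ) :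
    RcorrStar x (m + 1) N (fun _ => s)
      = (∑ n ∈ Finset.Icc 1 N, ((neighbours x N s n).card : ℝ) ^ m) / N := by
  unfold RcorrStar
  congr 1
  rw [Finset.card_eq_sum_card_fiberwise (f := fun i : Fin (m + 1) → ℕ => i 0)
    (t := Finset.Icc 1 N)]
  · push_cast
    refine Finset.sum_congr rfl fun n hn => ?_
    have h : ((neighbours x N s n).card) ^ m
        = (Fintype.piFinset fun _ : Fin m => neighbours x N s n).card := by simp
    rw [← Nat.cast_pow, h, Nat.cast_inj]
    refine Finset.card_bij' (fun i _ => Fin.tail i) (fun g _ => Fin.cons n g) ?_ ?_ ?_ ?_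
    · intro i hi
      simp only [Finset.mem_filter, Fintype.mem_piFinset] at hi
      obtain ⟨⟨h1, h2⟩, rfl⟩ := hi
      simp only [Fintype.mem_piFinset, neighbours, Finset.mem_filter]
      exact fun r => ⟨h1 r.succ, h2 r⟩
    · intro g hg
      simp only [Fintype.mem_piFinset, neighbours, Finset.mem_filter] at hg
      simp only [Finset.mem_filter, Fintype.mem_piFinset]
      exact ⟨⟨Fin.cases hn fun r => (hg r).1, fun r => (hg r).2⟩, rfl⟩
    · intro i hi
      simp only [Finset.mem_filter] at hi
      rw [← hi.2]
      exact Fin.cons_self_tail i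
    · intro g _
      exact Fin.tail_cons _ _
  · intro i hi
    simp only [Finset.coe_filter, Set.mem_ofPred_eq, Fintype.mem_piFinset] at hi
    exact hi.1 0

theorem Rcorr_eq_sum (x : ℕ → ℝ) (m N : ℕ) {s : ℝ} (hs : 0 ≤ s) :
    Rcorr x (m + 1) N (fun _ => s)
      = (∑ n ∈ Finset.Icc 1 N,
          ((((neighbours x N s n).card - 1).descFactorial m : ℕ) : ℝ)) / N := by
  unfold Rcorr
  congr 1
  rw [Finset.card_eq_sum_card_fiberwise (f := fun i : Fin (m + 1) → ℕ => i 0)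
    (t := Finset.Icc 1 N)]
  · push_cast
    refine Finset.sum_congr rfl fun n hn => ?_
    rw [← Finset.card_erase_of_mem (self_mem_neighbours x hs hn),
      ← card_filter_injective_piFinset, Nat.cast_inj]
    refine Finset.card_bij' (fun i _ => Fin.tail i) (fun g _ => Fin.cons n g) ?_ ?_ ?_ ?_
    · intro i hi
      simp only [Finset.mem_filter, Fintype.mem_piFinset] at hi
      obtain ⟨⟨h1, hinj, h2⟩, rfl⟩ := hi
      simp only [Fintype.mem_piFinset, neighbours, Finset.mem_filter, Finset.mem_erase]
      refine ⟨fun r => ⟨fun h => ?_, h1 r.succ, h2 r⟩, hinj.comp (Fin.succ_injective m)⟩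
      exact Fin.succ_ne_zero r (hinj h)
    · intro g hg
      simp only [Fintype.mem_piFinset, neighbours, Finset.mem_filter, Finset.mem_erase] at hg
      simp only [Finset.mem_filter, Fintype.mem_piFinset]
      refine ⟨⟨Fin.cases hn fun r => (hg.1 r).2.1, ?_, fun r => (hg.1 r).2.2⟩, rfl⟩
      refine Fin.cons_injective_iff.2 ⟨?_, hg.2⟩
      rintro ⟨r, hr⟩
      exact (hg.1 r).1 hr
    · intro i hi
      simp only [Finset.mem_filter] at hi
      rw [← hi.2]
      exact Fin.cons_self_tail i
    · intro g _
      exact Fin.tail_cons _ _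
  · intro i hi
    simp only [Finset.coe_filter, Set.mem_ofPred_eq, Fintype.mem_piFinset] at hi
    exact hi.1 0

theorem Rcorr_mono (x : ℕ → ℝ) (k N : ℕ) {s t : Fin (k - 1) → ℝ} (hst : ∀ r, s r ≤ t r) :
    Rcorr x k N s ≤ Rcorr x k N t := by
  unfold Rcorr
  gcongr with i hi _ r
  exact hst r

theorem Rcorr_le_RcorrStar (x : ℕ → ℝ) (k N : ℕ) (s : Fin (k - 1) → ℝ) :
    Rcorr x k N s ≤ RcorrStar x k N s := by
  unfold Rcorr RcorrStar
  gcongr with i hi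
  exact fun h => h.2

/-- Pigeonhole bound: on average a point has at least `s / 3` neighbours. -/
theorem mul_div_three_le_sum_card_neighbours (x : ℕ → ℝ) (hx : ∀ n, x n ∈ Set.Icc (0 : ℝ) 1)
    {N : ℕ} {s : ℝ} (hs : 0 < s) (hsN : s ≤ N) :
    (N : ℝ) * (s / 3) ≤ ∑ n ∈ Finset.Icc 1 N, ((neighbours x N s n).card : ℝ) := by
  have hN : (0 : ℝ) < N := hs.trans_le hsN
  obtain ⟨M, hMge, hMlt⟩ : ∃ M : ℕ, (N : ℝ) / s ≤ M ∧ (M : ℝ) < N / s + 1 :=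
    ⟨⌈(N : ℝ) / s⌉₊, Nat.le_ceil _, Nat.ceil_lt_add_one (by positivity)⟩
  have hMpos : (0 : ℝ) < M := lt_of_lt_of_le (by positivity) hMge
  have hone : 1 ≤ (N : ℝ) / s := (one_le_div hs).2 hsN
  let b : ℕ → ℕ := fun n => ⌊(M : ℝ) * x n⌋₊
  have hb : ∀ n ∈ Finset.Icc 1 N, b n ∈ Finset.range (M + 1) := by
    intro n _
    rw [Finset.mem_range, Nat.lt_succ_iff]
    refine Nat.floor_le_of_le ?_
    nlinarith [(hx n).2]
  have hfib : ∀ n ∈ Finset.Icc 1 N,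
      (((Finset.Icc 1 N).filter fun j => b j = b n).card : ℝ) ≤ (neighbours x N s n).card := by
    intro n _
    unfold neighbours
    gcongr with j hj
    intro hbj
    refine (nint_le_abs _).trans ?_
    have h1 := Nat.floor_le (mul_nonneg hMpos.le (hx n).1)
    have h2 := Nat.floor_le (mul_nonneg hMpos.le (hx j).1)
    have h3 := Nat.lt_floor_add_one ((M : ℝ) * x n)
    have h4 := Nat.lt_floor_add_one ((M : ℝ) * x j)
    have hbj' : ((⌊(M : ℝ) * x j⌋₊ : ℕ) : ℝ) = (⌊(M : ℝ) * x n⌋₊ : ℕ) := by exact_mod_cast hbj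
    have h5 : (M : ℝ) * |x n - x j| ≤ 1 := by
      rw [show (M : ℝ) * |x n - x j| = |M * (x n - x j)| by rw [abs_mul, abs_of_pos hMpos], abs_le]
      constructor <;> linarith
    rw [le_div_iff₀ hN]
    rw [div_le_iff₀ hs] at hMge
    nlinarith [abs_nonneg (x n - x j)]
  have hsum : ∑ n ∈ Finset.Icc 1 N, (((Finset.Icc 1 N).filter fun j => b j = b n).card : ℝ)
      = ∑ c ∈ Finset.range (M + 1), (((Finset.Icc 1 N).filter fun j => b j = c).card : ℝ) ^ 2 := by
    rw [← Finset.sum_fiberwise_of_maps_to hb]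
    refine Finset.sum_congr rfl fun c _ => ?_
    rw [Finset.sum_congr rfl (g := fun _ => (((Finset.Icc 1 N).filter fun j => b j = c).card : ℝ))]
    · rw [Finset.sum_const, nsmul_eq_mul, sq]
    · intro n hn
      rw [(Finset.mem_filter.1 hn).2]
  have hcard : ∑ c ∈ Finset.range (M + 1), (((Finset.Icc 1 N).filter fun j => b j = c).card : ℝ)
      = N := by
    have h := Finset.card_eq_sum_card_fiberwise hb
    rw [Nat.card_Icc, Nat.add_sub_cancel] at h
    exact_mod_cast h.symm
  have hcs := sq_sum_le_card_mul_sum_sq (s := Finset.range (M + 1))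
    (f := fun c => (((Finset.Icc 1 N).filter fun j => b j = c).card : ℝ))
  rw [hcard, ← hsum, Finset.card_range] at hcs
  have hle := Finset.sum_le_sum hfib
  refine le_trans ?_ hle
  have hT : 0 ≤ ∑ n ∈ Finset.Icc 1 N, (((Finset.Icc 1 N).filter fun j => b j = b n).card : ℝ) :=
    Finset.sum_nonneg fun _ _ => Nat.cast_nonneg _
  generalize ∑ n ∈ Finset.Icc 1 N, (((Finset.Icc 1 N).filter fun j => b j = b n).card : ℝ) = T
    at hcs hT ⊢
  have h3 : ((M + 1 : ℕ) : ℝ) ≤ 3 * (N / s) := by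
    rw [Nat.cast_add_one]
    linarith
  have h4 : (N : ℝ) ^ 2 ≤ 3 * (N / s) * T :=
    hcs.trans (mul_le_mul_of_nonneg_right h3 hT)
  have h5 : (3 : ℝ) * (N / s) * T = N * (3 * T / s) := by ring
  rw [h5, sq] at h4
  have h6 := le_of_mul_le_mul_left h4 hN
  rw [le_div_iff₀ hs] at h6
  linarith

theorem pow_sub_descFactorial_le {m d : ℕ} (hm : 1 ≤ m) (hd : 1 ≤ d) :
    (d : ℝ) ^ m - (((d - 1).descFactorial m : ℕ) : ℝ) ≤ m ^ 2 * (d : ℝ) ^ (m - 1) := by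
  have hd0 : (0 : ℝ) < d := by exact_mod_cast hd
  have hm1 : (1 : ℝ) ≤ m := by exact_mod_cast hm
  have hpow : (d : ℝ) ^ m = d * (d : ℝ) ^ (m - 1) := by rw [mul_comm, pow_sub_one_mul (by omega)]
  rcases le_or_gt m d with h | h
  · have h1 := Nat.pow_sub_le_descFactorial (d - 1) m
    rw [Nat.sub_add_cancel hd] at h1
    have h2 : ((d : ℝ) - m) ^ m ≤ (((d - 1).descFactorial m : ℕ) : ℝ) := by
      rw [← Nat.cast_sub h]
      exact_mod_cast h1
    have hmd : (m : ℝ) / d ≤ 1 := (div_le_one hd0).2 (by exact_mod_cast h)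
    have h3 := one_add_mul_le_pow (a := -((m : ℝ) / d)) (by linarith) m
    have h4 : ((d : ℝ) - m) ^ m = d ^ m * (1 + -((m : ℝ) / d)) ^ m := by
      rw [← mul_pow]
      congr 1
      field_simp
      ring
    have h5 : (d : ℝ) ^ m * (1 + m * -((m : ℝ) / d)) = d ^ m - m ^ 2 * (d : ℝ) ^ (m - 1) := by
      rw [hpow]
      field_simp
      ring
    have h6 := mul_le_mul_of_nonneg_left h3 (pow_nonneg hd0.le m)
    linarith
  · have h1 : (d : ℝ) ≤ m ^ 2 := by
      have : (d : ℝ) ≤ m := by exact_mod_cast h.le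
      nlinarith
    have h2 : (0 : ℝ) ≤ (((d - 1).descFactorial m : ℕ) : ℝ) := Nat.cast_nonneg _
    have h3 := mul_le_mul_of_nonneg_right h1 (pow_nonneg hd0.le (m - 1))
    linarith

theorem pow_le_two_pow_mul_descFactorial_add {m d : ℕ} (hd : 1 ≤ d) :
    (d : ℝ) ^ m ≤ 2 ^ m * (((d - 1).descFactorial m : ℕ) : ℝ) + (2 * m) ^ m := by
  rcases le_or_gt (2 * m) d with h | h
  · have h1 := Nat.pow_sub_le_descFactorial (d - 1) m
    rw [Nat.sub_add_cancel hd] at h1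
    have h2 : d ^ m ≤ 2 ^ m * (d - m) ^ m := by
      rw [← mul_pow]
      exact Nat.pow_le_pow_left (by omega) m
    have h3 : d ^ m ≤ 2 ^ m * (d - 1).descFactorial m :=
      h2.trans (Nat.mul_le_mul_left _ h1)
    have h4 : (d : ℝ) ^ m ≤ 2 ^ m * (((d - 1).descFactorial m : ℕ) : ℝ) := by exact_mod_cast h3
    have h5 : (0 : ℝ) ≤ (2 * m) ^ m := by positivity
    linarith
  · have h1 : (d : ℝ) ≤ 2 * m := by exact_mod_cast h.le
    have h2 : (d : ℝ) ^ m ≤ (2 * m) ^ m := by gcongr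
    have h3 : (0 : ℝ) ≤ 2 ^ m * (((d - 1).descFactorial m : ℕ) : ℝ) := by positivity
    linarith

theorem mul_pow_pred_le_pow_add_pow {m : ℕ} (hm : 1 ≤ m) {d s : ℝ} (hd : 0 ≤ d) (hs : 0 ≤ s) :
    s * d ^ (m - 1) ≤ d ^ m + s ^ m := by
  have hd' : d ^ m = d * d ^ (m - 1) := by rw [mul_comm, pow_sub_one_mul (by omega)]
  have hs' : s ^ m = s * s ^ (m - 1) := by rw [mul_comm, pow_sub_one_mul (by omega)]
  have h1 := pow_nonneg hd m
  have h2 := pow_nonneg hs m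
  rcases le_total s d with h | h
  · have h3 : s * d ^ (m - 1) ≤ d * d ^ (m - 1) := by gcongr
    linarith
  · have h3 : s * d ^ (m - 1) ≤ s * s ^ (m - 1) := by gcongr
    linarith

theorem RcorrStar_le_Rcorr_add (x : ℕ → ℝ) (hx : ∀ n, x n ∈ Set.Icc (0 : ℝ) 1) {m N : ℕ}
    (hm : 1 ≤ m) {s : ℝ} (hs : 12 * m ≤ s) (hsN : s ≤ N) :
    RcorrStar x (m + 1) N (fun _ => s) ≤ Rcorr x (m + 1) N (fun _ => s)
      + m ^ 2 * (1 + 3 ^ m) * 2 ^ (m + 1) / s * Rcorr x (m + 1) N (fun _ => s) := by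
  have hm1 : (1 : ℝ) ≤ m := by exact_mod_cast hm
  have hs0 : 0 < s := by linarith
  have hN : (0 : ℝ) < N := hs0.trans_le hsN
  rw [RcorrStar_eq_sum, Rcorr_eq_sum x m N hs0.le]
  have hd : ∀ n ∈ Finset.Icc 1 N, 1 ≤ (neighbours x N s n).card := fun n hn =>
    Finset.card_pos.2 ⟨n, self_mem_neighbours x hs0.le hn⟩
  have hconst : ∀ c : ℝ, ∑ _n ∈ Finset.Icc 1 N, c = N * c := by simp
  have hdiff := Finset.sum_le_sum fun n hn => pow_sub_descFactorial_le hm (hd n hn)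
  have hdesc := Finset.sum_le_sum fun n hn => pow_le_two_pow_mul_descFactorial_add (m := m) (hd n hn)
  have hpred := Finset.sum_le_sum fun n (_ : n ∈ Finset.Icc 1 N) =>
    mul_pow_pred_le_pow_add_pow hm (Nat.cast_nonneg (neighbours x N s n).card) hs0.le
  rw [Finset.sum_sub_distrib, ← Finset.mul_sum] at hdiff
  rw [Finset.sum_add_distrib, ← Finset.mul_sum, hconst] at hdesc
  rw [Finset.sum_add_distrib, ← Finset.mul_sum, hconst] at hpred
  have hmean : (N : ℝ) * (s / 3) ^ m
      ≤ ∑ n ∈ Finset.Icc 1 N, ((neighbours x N s n).card : ℝ) ^ m := by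
    obtain ⟨l, rfl⟩ : ∃ l, m = l + 1 := ⟨m - 1, by omega⟩
    have h0 := mul_div_three_le_sum_card_neighbours x hx hs0 hsN
    have h1 := pow_sum_le_card_mul_sum_pow (s := Finset.Icc 1 N)
      (f := fun n => ((neighbours x N s n).card : ℝ)) (fun _ _ => Nat.cast_nonneg _) l
    have h2 := (pow_le_pow_left₀ (by positivity) h0 (l + 1)).trans h1
    rw [Nat.card_Icc, Nat.add_sub_cancel, mul_pow, pow_succ (N : ℝ), mul_assoc] at h2
    exact le_of_mul_le_mul_left h2 (pow_pos hN l)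
  set P := ∑ n ∈ Finset.Icc 1 N, ((neighbours x N s n).card : ℝ) ^ m
  set Q := ∑ n ∈ Finset.Icc 1 N, ((neighbours x N s n).card : ℝ) ^ (m - 1)
  set F := ∑ n ∈ Finset.Icc 1 N, ((((neighbours x N s n).card - 1).descFactorial m : ℕ) : ℝ)
  have hsmall : 2 * (2 * (m : ℝ)) ^ m ≤ (s / 3) ^ m := by
    calc 2 * (2 * (m : ℝ)) ^ m ≤ 2 ^ m * (2 * (m : ℝ)) ^ m := by
          gcongr
          exact le_self_pow₀ (by norm_num) (by omega)
      _ = (4 * (m : ℝ)) ^ m := by rw [← mul_pow]; ring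
      _ ≤ (s / 3) ^ m := by gcongr; linarith
  have hPF : P ≤ 2 ^ (m + 1) * F := by
    have := mul_le_mul_of_nonneg_left hsmall hN.le
    rw [pow_succ]
    linarith
  have hsP : N * s ^ m ≤ 3 ^ m * P := by
    have := mul_le_mul_of_nonneg_left hmean (show (0 : ℝ) ≤ 3 ^ m by positivity)
    rwa [div_pow, mul_left_comm, mul_div_cancel₀ _ (by positivity)] at this
  have hQ : s * Q ≤ (1 + 3 ^ m) * 2 ^ (m + 1) * F := by
    calc s * Q ≤ (1 + 3 ^ m) * P := by linarith
      _ ≤ (1 + 3 ^ m) * (2 ^ (m + 1) * F) := by gcongr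
      _ = _ := by ring
  have hQ' : m ^ 2 * Q ≤ m ^ 2 * (1 + 3 ^ m) * 2 ^ (m + 1) / s * F := by
    rw [div_mul_eq_mul_div, le_div_iff₀ hs0]
    have := mul_le_mul_of_nonneg_left hQ (sq_nonneg (m : ℝ))
    linarith
  rw [← mul_div_assoc, ← add_div]
  gcongr
  linarith

theorem HasPoissonianCorr.tendsto_Rcorr {x : ℕ → ℝ} {k : ℕ} (h : HasPoissonianCorr x k)
    {s : ℝ} (hs : 0 ≤ s) :
    Tendsto (fun N : ℕ => Rcorr x k N fun _ => s) atTop (nhds ((2 * s) ^ (k - 1))) := by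
  have h1 := h (fun _ => -s) (fun _ => s) fun _ => by linarith
  have h2 : ∏ _r : Fin (k - 1), (s - -s) = (2 * s) ^ (k - 1) := by
    rw [Finset.prod_const, Finset.card_univ, Fintype.card_fin]
    ring
  rw [h2] at h1
  refine h1.congr' ?_
  filter_upwards [eventually_ge_atTop 1] with N hN
  have hN' : (0 : ℝ) < N := by exact_mod_cast hN
  simp only [corrBoxCount, Rcorr, mul_sdist_mem_Icc_iff hN']

/-- For any sequence in `[0,1]` there are constants `s₀, C > 0` depending only
on `k` such that for all `s ≥ s₀`: (a) for all sufficiently large `N`,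
`R_k(s,N) ≤ R_k^*(s,N) ≤ R_k(s,N) + (C/s)·R_k(3^k s, N)`; and (b) if moreover the sequence has
Poissonian `k`-th order correlations, `limsup_N |R_k^*(s,N) − (2s)^{k-1}| ≤ C·s^{k-2}`. -/
theorem RcorrStar_eq_Rcorr_up_to_error
    (k : ℕ) (hk : 2 ≤ k) :
    ∃ s₀ > (0:ℝ), ∃ C > (0:ℝ),
      ∀ x : ℕ → ℝ, (∀ n, x n ∈ Set.Icc (0 : ℝ) 1) →
        ((∀ s : ℝ, s₀ ≤ s → ∃ N₀ : ℕ, ∀ N : ℕ, N₀ ≤ N →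
            Rcorr x k N (fun _ => s) ≤ RcorrStar x k N (fun _ => s) ∧
            RcorrStar x k N (fun _ => s) ≤
              Rcorr x k N (fun _ => s) + C / s * Rcorr x k N (fun _ => 3 ^ k * s)) ∧
          (HasPoissonianCorr x k → ∀ s : ℝ, s₀ ≤ s →
            Filter.limsup
                (fun N : ℕ => |RcorrStar x k N (fun _ => s) - (2 * s) ^ (k - 1)|) atTop
              ≤ C * s ^ (k - 2))) := by
  obtain ⟨m, rfl⟩ : ∃ m, k = m + 1 := ⟨k - 1, by omega⟩
  have hm : 1 ≤ m := by omega
  have hm1 : (1 : ℝ) ≤ m := by exact_mod_cast hm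
  set A : ℝ := m ^ 2 * (1 + 3 ^ m) * 2 ^ (m + 1) with hA
  have hA0 : 0 < A := by positivity
  have hA2 : A ≤ A * 2 ^ m := le_mul_of_one_le_right hA0.le (one_le_pow₀ (by norm_num))
  refine ⟨12 * m, by positivity, A * 2 ^ m, by positivity, fun x hx => ⟨fun s hs => ?_,
    fun hP s hs => ?_⟩⟩
  · have hs0 : 0 < s := by linarith
    refine ⟨⌈s⌉₊, fun N hN => ⟨Rcorr_le_RcorrStar x _ N _, ?_⟩⟩
    refine (RcorrStar_le_Rcorr_add x hx hm hs (Nat.ceil_le.1 hN)).trans ?_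
    have hR : 0 ≤ Rcorr x (m + 1) N fun _ => s := by unfold Rcorr; positivity
    have hmono : Rcorr x (m + 1) N (fun _ => s) ≤ Rcorr x (m + 1) N fun _ => 3 ^ (m + 1) * s :=
      Rcorr_mono x _ N fun _ => le_mul_of_one_le_left hs0.le (one_le_pow₀ (by norm_num))
    gcongr
  · have hs0 : 0 < s := by linarith
    have hlim := hP.tendsto_Rcorr hs0.le
    simp only [Nat.add_sub_cancel] at hlim ⊢
    have hbound : Tendsto (fun N : ℕ => |Rcorr x (m + 1) N (fun _ => s) - (2 * s) ^ m|
        + A / s * Rcorr x (m + 1) N (fun _ => s)) atTop (nhds (A * 2 ^ m * s ^ (m - 1))) := by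
      have h := (hlim.sub_const ((2 * s) ^ m)).abs.add (hlim.const_mul (A / s))
      convert h using 2
      rw [sub_self, abs_zero, zero_add, mul_pow, ← pow_sub_one_mul (by omega : m ≠ 0) s]
      field_simp
    rw [show m + 1 - 2 = m - 1 by omega, ← hbound.limsup_eq]
    refine limsup_le_limsup ?_ ?_ hbound.isBoundedUnder_le
    · filter_upwards [eventually_ge_atTop ⌈s⌉₊] with N hN
      have h1 := Rcorr_le_RcorrStar x (m + 1) N fun _ => s
      have h2 := RcorrStar_le_Rcorr_add x hx hm hs (Nat.ceil_le.1 hN)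
      rw [← hA] at h2
      rw [abs_le]
      have h3 := le_abs_self (Rcorr x (m + 1) N (fun _ => s) - (2 * s) ^ m)
      have h4 := neg_abs_le (Rcorr x (m + 1) N (fun _ => s) - (2 * s) ^ m)
      constructor <;> linarith
    · exact isCoboundedUnder_le_of_le atTop fun N => abs_nonneg _
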